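/- Let N ≥ 2 be even and let P = (P⁽¹⁾,P⁽²⁾,P⁽³⁾) be a 3-dimensional homogeneous polynomial of degree N with coefficients p_α⁽ʲ⁾ such that P is divergence-free (Σ_j ∂P⁽ʲ⁾/∂x_j = 0), curl-free (∂P⁽ʲ⁾/∂x_l = ∂P⁽ˡ⁾/∂x_j for all j,l), and each component P⁽ʲ⁾ is harmonic. Then σ(ρ) divides 𝓘[P](ρ) in ℂ[ρ₁,ρ₂,ρ₃] if and only if for each j = 1,2,3 the product ∏_{i≠j} x_i divides P⁽ʲ⁾, i.e. P⁽ʲ⁾(x) = x^{𝟙−e_j}·Q⁽ʲ⁾(x) for some homogeneous polynomial Q⁽ʲ⁾ of degree N−2. -/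

import Mathlib

open MvPolynomial

/-- The multi-index `𝟙 − e_j`, i.e. ones everywhere except at `j` where it is `0`. -/
noncomputable def onesHat (j : Fin 3) : Fin 3 →₀ ℕ :=
  ∑ i ∈ Finset.univ.erase j, Finsupp.single i 1

/-- The homogeneous polynomial `𝓘[P](ρ) = Σ_{j} Σ_{α_j=0} p_α⁽ʲ⁾ · α! · ρ^{α+𝟙−e_j}`
associated with a 3-dimensional (homogeneous) polynomial `P`. -/
noncomputable def calI (P : Fin 3 → MvPolynomial (Fin 3) ℂ) : MvPolynomial (Fin 3) ℂ :=
  ∑ j : Fin 3, ∑ α ∈ (P j).support.filter (fun α => α j = 0),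
    monomial (α + onesHat j) (coeff α (P j) * ∏ i, (Nat.factorial (α i) : ℂ))

/-- `σ(ρ) = ρ₂²ρ₃² + ρ₁²ρ₃² + ρ₁²ρ₂²`. -/
noncomputable def sigma3 : MvPolynomial (Fin 3) ℂ :=
  X 1 ^ 2 * X 2 ^ 2 + X 0 ^ 2 * X 2 ^ 2 + X 0 ^ 2 * X 1 ^ 2

/-- The coefficient of `x^α` in `p`, multiplied by `α!`. -/
noncomputable def factorialCoeff (p : MvPolynomial (Fin 3) ℂ) (α : Fin 3 →₀ ℕ) : ℂ :=
  coeff α p * ∏ i, (Nat.factorial (α i) : ℂ)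

lemma factorialCoeff_eq_zero_iff (p : MvPolynomial (Fin 3) ℂ) (α : Fin 3 →₀ ℕ) :
    factorialCoeff p α = 0 ↔ coeff α p = 0 := by
  have : ∏ i, (Nat.factorial (α i) : ℂ) ≠ 0 :=
    Finset.prod_ne_zero_iff.2 fun i _ => Nat.cast_ne_zero.2 (Nat.factorial_ne_zero _)
  simp [factorialCoeff, this]

lemma factorialCoeff_sum {ι : Type*} (s : Finset ι) (f : ι → MvPolynomial (Fin 3) ℂ)
    (α : Fin 3 →₀ ℕ) :
    factorialCoeff (∑ j ∈ s, f j) α = ∑ j ∈ s, factorialCoeff (f j) α := by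
  simp [factorialCoeff, coeff_sum, Finset.sum_mul]

lemma factorialCoeff_pderiv (i : Fin 3) (p : MvPolynomial (Fin 3) ℂ) (α : Fin 3 →₀ ℕ) :
    factorialCoeff (pderiv i p) α = factorialCoeff p (α + Finsupp.single i 1) := by
  rw [factorialCoeff, factorialCoeff, coeff_pderiv]
  fin_cases i <;> simp [Fin.prod_univ_three, Nat.factorial_succ] <;> ring

lemma onesHat_apply (j i : Fin 3) : onesHat j i = if i = j then 0 else 1 := by
  fin_cases j <;> fin_cases i <;> simp [onesHat, Finsupp.single_apply]

lemma onesHat_le_iff (j : Fin 3) (α : Fin 3 →₀ ℕ) : onesHat j ≤ α ↔ ∀ i ≠ j, α i ≠ 0 := by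
  refine forall_congr' fun i => ?_
  rw [onesHat_apply]
  split_ifs with h <;> simp [h, Nat.one_le_iff_ne_zero]

lemma prod_X_eq_monomial_onesHat (j : Fin 3) :
    (∏ i ∈ Finset.univ.erase j, X i : MvPolynomial (Fin 3) ℂ) = monomial (onesHat j) 1 := by
  rw [onesHat, monomial_sum_one]
  rfl

lemma degree_onesHat (j : Fin 3) : (onesHat j).degree = 2 := by
  simp [onesHat, map_sum]

lemma exists_eq_prod_X_mul_iff {N : ℕ} {p : MvPolynomial (Fin 3) ℂ} (hp : p.IsHomogeneous N)
    (j : Fin 3) :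
    (∃ Q : MvPolynomial (Fin 3) ℂ, Q.IsHomogeneous (N - 2) ∧
        p = (∏ i ∈ Finset.univ.erase j, X i) * Q) ↔
      ∀ α, ∀ i ≠ j, α i = 0 → factorialCoeff p α = 0 := by
  simp only [factorialCoeff_eq_zero_iff, prod_X_eq_monomial_onesHat]
  constructor
  · rintro ⟨Q, -, rfl⟩ α i hij hi
    rw [coeff_monomial_mul', if_neg]
    exact fun h => (onesHat_le_iff j α).1 h i hij hi
  · intro h
    refine ⟨p.divMonomial (onesHat j), fun d hd => ?_, ?_⟩
    · rw [coeff_divMonomial] at hd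
      have hdeg : (onesHat j + d).degree = N := by
        rw [Finsupp.degree_eq_weight_one]
        exact hp hd
      rw [map_add, degree_onesHat] at hdeg
      have : d.degree = N - 2 := by omega
      rwa [Finsupp.degree_eq_weight_one] at this
    · ext α
      rw [coeff_monomial_mul']
      split_ifs with hα
      · rw [coeff_divMonomial, add_tsub_cancel_of_le hα, one_mul]
      · rw [onesHat_le_iff] at hα
        push Not at hα
        obtain ⟨i, hij, hi⟩ := hα
        exact h α i hij hi

lemma coeff_calI (P : Fin 3 → MvPolynomial (Fin 3) ℂ) (γ : Fin 3 →₀ ℕ) :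
    coeff γ (calI P) = ∑ j, if onesHat j ≤ γ ∧ γ j = 0 then
      factorialCoeff (P j) (γ - onesHat j) else 0 := by
  simp only [calI, coeff_sum, coeff_monomial]
  refine Finset.sum_congr rfl fun j _ => ?_
  split_ifs with h
  · rw [Finset.sum_eq_single (γ - onesHat j)]
    · rw [if_pos (tsub_add_cancel_of_le h.1), factorialCoeff]
    · intro α _ hα
      refine if_neg fun h' => hα ?_
      rw [← h', add_tsub_cancel_right]
    · intro hα
      have : coeff (γ - onesHat j) (P j) = 0 := by
        by_contra h'
        exact hα (Finset.mem_filter.2 ⟨mem_support_iff.2 h', by simp [h.2]⟩)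
      simp [this]
  · refine Finset.sum_eq_zero fun α hα => if_neg ?_
    rintro rfl
    refine h ⟨le_add_self, ?_⟩
    simp [onesHat_apply, (Finset.mem_filter.1 hα).2]

lemma sigma3_eq_sum : sigma3 = ∑ j, monomial (onesHat j + onesHat j) (1 : ℂ) := by
  have (j : Fin 3) : monomial (onesHat j + onesHat j) (1 : ℂ) =
      (∏ i ∈ Finset.univ.erase j, X i) * (∏ i ∈ Finset.univ.erase j, X i) := by
    rw [prod_X_eq_monomial_onesHat, monomial_mul, one_mul]
  have h0 : Finset.univ.erase (0 : Fin 3) = {1, 2} := by decide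
  have h1 : Finset.univ.erase (1 : Fin 3) = {0, 2} := by decide
  have h2 : Finset.univ.erase (2 : Fin 3) = {0, 1} := by decide
  simp [sigma3, Fin.sum_univ_three, this, h0, h1, h2]
  ring

lemma coeff_sigma3_mul (R : MvPolynomial (Fin 3) ℂ) (γ : Fin 3 →₀ ℕ) :
    coeff γ (sigma3 * R) = ∑ j, if onesHat j + onesHat j ≤ γ then
      coeff (γ - (onesHat j + onesHat j)) R else 0 := by
  simp [sigma3_eq_sum, Finset.sum_mul, coeff_sum, coeff_monomial_mul']

/-- A polynomial that does not involve one of the variables is divisible by `σ` only if it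
vanishes. -/
lemma eq_zero_of_sigma3_dvd {F : MvPolynomial (Fin 3) ℂ} (h : sigma3 ∣ F) (j : Fin 3)
    (hF : degreeOf j F = 0) : F = 0 := by
  obtain ⟨R, rfl⟩ := h
  by_contra hne
  rw [degreeOf_mul_eq (left_ne_zero_of_mul hne) (right_ne_zero_of_mul hne)] at hF
  have hmem : onesHat (j + 1) + onesHat (j + 1) ∈ (sigma3).support := by
    have hinj (k l : Fin 3) : onesHat k + onesHat k = onesHat l + onesHat l ↔ k = l := by
      refine ⟨fun h => ?_, fun h => h ▸ rfl⟩
      have := DFunLike.congr_fun h k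
      by_contra hkl
      simp [onesHat_apply, hkl] at this
    simp [mem_support_iff, sigma3_eq_sum, coeff_sum, coeff_monomial, hinj]
  have := monomial_le_degreeOf j hmem
  simp [onesHat_apply] at this
  omega

lemma weightedHomogeneousComponent_mul_of_left_mem_zero {σ R M : Type*} [CommSemiring R]
    [AddCommMonoid M] [DecidableEq M] (w : σ → M) {p : MvPolynomial σ R}
    (hp : p.IsWeightedHomogeneous w 0) (q : MvPolynomial σ R) (m : M) :
    weightedHomogeneousComponent w m (p * q) = p * weightedHomogeneousComponent w m q := by
  let _ := weightedGradedAlgebra R w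
  have := DirectSum.coe_decompose_mul_of_left_mem_zero (weightedHomogeneousSubmodule R w) (j := m)
    (b := q) hp
  rwa [← weightedDecomposition.decompose'_apply, ← weightedDecomposition.decompose'_apply]

/-- The parity of the exponents, as a weight on the variables. -/
def parityWeight : Fin 3 → Fin 3 → ZMod 2 := fun i => Pi.single i 1

lemma weight_parityWeight (α : Fin 3 →₀ ℕ) (i : Fin 3) :
    Finsupp.weight parityWeight α i = α i := by
  rw [Finsupp.weight_apply, Finsupp.sum_fintype _ _ (by simp), Finset.sum_apply]
  simp [parityWeight, Pi.single_apply]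

lemma sigma3_isWeightedHomogeneous : sigma3.IsWeightedHomogeneous parityWeight 0 := by
  rw [sigma3_eq_sum]
  refine IsWeightedHomogeneous.sum _ _ _ fun j _ => isWeightedHomogeneous_monomial _ _ _ ?_
  ext i
  rw [weight_parityWeight]
  simpa using CharTwo.add_self_eq_zero _

lemma factorialCoeff_eq_zero_of_sigma3_dvd {P : Fin 3 → MvPolynomial (Fin 3) ℂ}
    (h : sigma3 ∣ calI P) (j : Fin 3) (α : Fin 3 →₀ ℕ) (heven : ∀ i, Even (α i))
    (hj : α j = 0) : factorialCoeff (P j) α = 0 := by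
  set w := Finsupp.weight parityWeight (onesHat j) with hw
  set F := weightedHomogeneousComponent parityWeight w (calI P) with hF
  have hdvd : sigma3 ∣ F := by
    obtain ⟨R, hR⟩ := h
    exact ⟨_, by rw [hF, hR,
      weightedHomogeneousComponent_mul_of_left_mem_zero _ sigma3_isWeightedHomogeneous]⟩
  have hdeg : degreeOf j F = 0 := by
    rw [← Nat.le_zero, degreeOf_le_iff]
    intro γ hγ
    rw [mem_support_iff, hF, coeff_weightedHomogeneousComponent, ite_ne_right_iff, coeff_calI]
      at hγ
    obtain ⟨hγ, hne⟩ := hγ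
    by_contra hjγ
    refine hne (Finset.sum_eq_zero fun k _ => if_neg ?_)
    rintro ⟨-, hk⟩
    have := congrFun hγ k
    rw [hw, weight_parityWeight, weight_parityWeight, onesHat_apply, hk] at this
    by_cases hkj : k = j
    · subst hkj; omega
    · simp [hkj] at this
  have hcoeff : coeff (α + onesHat j) F = 0 := by
    rw [eq_zero_of_sigma3_dvd hdvd j hdeg, coeff_zero]
  have hα : Finsupp.weight parityWeight (α + onesHat j) = w := by
    rw [map_add, add_eq_right]
    ext i
    rw [weight_parityWeight]
    exact (ZMod.natCast_eq_zero_iff_even).2 (heven i)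
  rw [hF, coeff_weightedHomogeneousComponent, if_pos hα, coeff_calI,
    Finset.sum_eq_single j] at hcoeff
  · simpa [hj, onesHat_apply] using hcoeff
  · intro k _ hk
    refine if_neg fun h' => ?_
    simpa [onesHat_apply, hk] using h'.2
  · simp

/-- A solution of the discrete harmonic relation is determined on even multi-indices by its
values on those with a given exponent equal to zero. -/
lemma eq_zero_of_even_of_harmonic {ι : Type*} [Fintype ι] {q : (ι →₀ ℕ) → ℂ}
    (hq : ∀ α, ∑ l, q (α + Finsupp.single l 2) = 0) (i : ι)
    (h0 : ∀ α : ι →₀ ℕ, (∀ k, Even (α k)) → α i = 0 → q α = 0) (α : ι →₀ ℕ)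
    (hα : ∀ k, Even (α k)) : q α = 0 := by
  classical
  induction hn : α i using Nat.strong_induction_on generalizing α with
  | _ n ih =>
    by_cases hi : α i = 0
    · exact h0 α hα hi
    have h2 : 2 ≤ α i := by
      obtain ⟨m, hm⟩ := hα i
      omega
    obtain ⟨β, rfl⟩ := exists_add_of_le (Finsupp.single_le_iff.2 h2)
    have hsum := hq β
    rw [Finset.sum_eq_single i, add_comm] at hsum
    · exact hsum
    · intro l _ hl
      have hβi : ((β + Finsupp.single l 2 : ι →₀ ℕ)) i = β i := by simp [hl]
      refine ih (β i) (by simp at hn; omega) _ (fun k => ?_) hβi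
      have := hα k
      rw [Finsupp.add_apply, Finsupp.single_apply] at this ⊢
      split_ifs at this ⊢ <;> simpa [Nat.even_add] using this
    · simp

lemma factorialCoeff_eq_zero_of_even {N : ℕ} (heven : Even N)
    {P : Fin 3 → MvPolynomial (Fin 3) ℂ} (hhom : ∀ j, (P j).IsHomogeneous N)
    (hcurl : ∀ j l : Fin 3, pderiv l (P j) = pderiv j (P l))
    (h : ∀ j α, (∀ i, Even (α i)) → factorialCoeff (P j) α = 0)
    (j : Fin 3) (α : Fin 3 →₀ ℕ) (i : Fin 3) (hij : i ≠ j) (hi : α i = 0) :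
    factorialCoeff (P j) α = 0 := by
  by_contra hne
  have hdeg : α.degree = N := by
    rw [Finsupp.degree_eq_weight_one]
    exact hhom j (mt (factorialCoeff_eq_zero_iff _ _).2 hne)
  obtain ⟨k, hki, hkj, huniv⟩ : ∃ k, k ≠ i ∧ k ≠ j ∧ ∀ l, l = i ∨ l = j ∨ l = k := by
    clear * - hij; revert i j; decide
  have hsum : α.degree = α i + (α j + α k) := by
    have : (Finset.univ : Finset (Fin 3)) = {i, j, k} := by
      ext l; simpa using huniv l
    rw [Finsupp.degree_eq_sum, this, Finset.sum_insert (by simp [hij, hki.symm]),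
      Finset.sum_pair hkj.symm]
  rw [← hdeg, hsum, hi, zero_add, Nat.even_add] at heven
  by_cases hk : Even (α k)
  · refine hne (h j α fun l => ?_)
    obtain rfl | rfl | rfl := huniv l
    exacts [by simp [hi], heven.2 hk, hk]
  · have hk1 : 1 ≤ α k := by
      by_contra h0
      simp [show α k = 0 by omega] at hk
    obtain ⟨β, rfl⟩ := exists_add_of_le (Finsupp.single_le_iff.2 hk1)
    rw [add_comm, ← factorialCoeff_pderiv, hcurl, factorialCoeff_pderiv] at hne
    refine hne (h k _ fun l => ?_)
    simp [hkj.symm, hki.symm, Nat.even_add] at hi heven hk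
    obtain rfl | rfl | rfl := huniv l <;>
      simp [hkj, hij, Nat.even_add] <;> grind

lemma sigma3_dvd_calI {P : Fin 3 → MvPolynomial (Fin 3) ℂ}
    (hdiv : ∑ j : Fin 3, pderiv j (P j) = 0)
    (hcurl : ∀ j l : Fin 3, pderiv l (P j) = pderiv j (P l))
    (h : ∀ j α, ∀ i ≠ j, α i = 0 → factorialCoeff (P j) α = 0) :
    sigma3 ∣ calI P := by
  set G : MvPolynomial (Fin 3) ℂ :=
    ∑ α ∈ (P 0).support, monomial α (factorialCoeff (P 0) α) with hG
  have hGcoeff (α) : coeff α G = factorialCoeff (P 0) α := by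
    rw [hG]
    simp only [coeff_sum, coeff_monomial, Finset.sum_ite_eq', mem_support_iff]
    by_cases hα : coeff α (P 0) = 0 <;> simp [hα, factorialCoeff]
  have hshift (j l : Fin 3) (δ : Fin 3 →₀ ℕ) : factorialCoeff (P j) (onesHat j + δ) =
      factorialCoeff (P l) (onesHat l + δ) := by
    by_cases hjl : j = l
    · rw [hjl]
    have hones : ∃ ε, onesHat j = ε + Finsupp.single l 1 ∧ onesHat l = ε + Finsupp.single j 1 := by
      refine ⟨onesHat j - Finsupp.single l 1, ?_, ?_⟩ <;> ext i <;>
        simp only [onesHat_apply, Finsupp.add_apply, Finsupp.tsub_apply, Finsupp.single_apply] <;>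
        grind
    obtain ⟨ε, hj, hl⟩ := hones
    rw [hj, hl, add_right_comm, ← factorialCoeff_pderiv, hcurl, factorialCoeff_pderiv,
      add_right_comm]
  refine ⟨G.divMonomial (onesHat 0), ?_⟩
  ext γ
  have hterm (j : Fin 3) : (if onesHat j + onesHat j ≤ γ then
      coeff (γ - (onesHat j + onesHat j)) (G.divMonomial (onesHat 0)) else 0) =
      if onesHat j ≤ γ then factorialCoeff (P j) (γ - onesHat j) else 0 := by
    rw [coeff_divMonomial, hGcoeff, hshift 0 j]
    by_cases h1 : onesHat j ≤ γ
    · obtain ⟨β, rfl⟩ := exists_add_of_le h1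
      simp only [h1, if_true, add_le_add_iff_left, add_tsub_add_eq_tsub_left,
        add_tsub_cancel_left]
      split_ifs with h2
      · rw [add_tsub_cancel_of_le h2]
      · rw [onesHat_le_iff] at h2
        push Not at h2
        obtain ⟨i, hij, hi⟩ := h2
        exact (h j β i hij hi).symm
    · rw [if_neg h1, if_neg fun h2 => h1 (le_self_add.trans h2)]
  rw [coeff_calI, coeff_sigma3_mul]
  simp_rw [hterm]
  by_cases hγ : ∃ i, γ i = 0
  · obtain ⟨i, hi⟩ := hγ
    refine Finset.sum_congr rfl fun j _ => ?_
    by_cases hij : i = j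
    · simp [← hij, hi]
    · have : ¬ onesHat j ≤ γ := fun h' => (onesHat_le_iff j γ).1 h' i hij hi
      simp [this]
  · push Not at hγ
    have hle (j : Fin 3) : onesHat j ≤ γ := (onesHat_le_iff j γ).2 fun i _ => hγ i
    simp only [hγ, hle, and_false, if_true, if_false, Finset.sum_const_zero]
    obtain ⟨ε, rfl⟩ : ∃ ε, γ = ε + (onesHat 0 + Finsupp.single 0 1) := by
      refine ⟨_, (tsub_add_cancel_of_le fun i => ?_).symm⟩
      have := Nat.one_le_iff_ne_zero.2 (hγ i)
      fin_cases i <;> simpa [onesHat_apply] using this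
    have hsum := congrArg (fun p => factorialCoeff p ε) hdiv
    simp only [factorialCoeff_sum, factorialCoeff_pderiv] at hsum
    rw [show factorialCoeff 0 ε = 0 by simp [factorialCoeff]] at hsum
    rw [← hsum]
    refine Finset.sum_congr rfl fun j _ => congrArg _ ?_
    ext i
    fin_cases j <;> fin_cases i <;> simp [onesHat_apply]

/-- for even `N ≥ 2` and `P` a divergence-free, curl-free, componentwise
harmonic 3-dimensional homogeneous polynomial of degree `N`, `σ ∣ 𝓘[P]` if and only if
each `P⁽ʲ⁾` has the form `P⁽ʲ⁾(x) = x^{𝟙−e_j}·Q⁽ʲ⁾(x)` with `Q⁽ʲ⁾` homogeneous of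
degree `N − 2`. -/
theorem sigma_dvd_calI_iff_even (N : ℕ) (hN : 2 ≤ N) (heven : Even N)
    (P : Fin 3 → MvPolynomial (Fin 3) ℂ)
    (hhom : ∀ j, (P j).IsHomogeneous N)
    (hdiv : ∑ j : Fin 3, pderiv j (P j) = 0)
    (hcurl : ∀ j l : Fin 3, pderiv l (P j) = pderiv j (P l))
    (hharm : ∀ j : Fin 3, ∑ l : Fin 3, pderiv l (pderiv l (P j)) = 0) :
    sigma3 ∣ calI P ↔
      ∀ j : Fin 3, ∃ Q : MvPolynomial (Fin 3) ℂ, Q.IsHomogeneous (N - 2) ∧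
        P j = (∏ i ∈ Finset.univ.erase j, X i) * Q := by
  simp_rw [exists_eq_prod_X_mul_iff (hhom _)]
  refine ⟨fun h => ?_, sigma3_dvd_calI hdiv hcurl⟩
  refine factorialCoeff_eq_zero_of_even heven hhom hcurl fun j => ?_
  refine eq_zero_of_even_of_harmonic (fun α => ?_) j
    (factorialCoeff_eq_zero_of_sigma3_dvd h j)
  have := congrArg (fun p => factorialCoeff p α) (hharm j)
  simpa [factorialCoeff_sum, factorialCoeff_pderiv, add_assoc, ← Finsupp.single_add,
    (factorialCoeff_eq_zero_iff 0 α).2 (coeff_zero α)] using this
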